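/- arXiv:1712.09346 — 3 statements merged into one kernel-verified Lean document; each statement's English description precedes it below -/
import Mathlib

section
/- Let p be a prime and B a commutative ring such that the canonical ring homomorphism ℤ → B is injective. Let S = {x ∈ W(B) : x.coeff 0 lies in the image of ℤ → B}. Then: (1) S is a subring of W(B); (2) every x ∈ S can be written uniquely as x = n + V(z) with n ∈ ℤ and z ∈ W(B); and (3) the lateral Frobenius 𝔣 : S → S defined by 𝔣(n + V(z)) = n + V(F(z)) is a ring homomorphism. -/
theorem lat_aux_mul {p : ℕ} [hp : Fact p.Prime] {B : Type*} [CommRing B]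
    (n m : ℤ) (z w : WittVector p B) :
    ((n : WittVector p B) + WittVector.verschiebung z) * ((m : WittVector p B) + WittVector.verschiebung w) =
      ((n * m : ℤ) : WittVector p B) +
        WittVector.verschiebung ((n : WittVector p B) * w + (m : WittVector p B) * z + z * (w * (p : WittVector p B))) := by
  have h1 : ∀ (k : ℤ) (y : WittVector p B),
      WittVector.verschiebung ((k : WittVector p B) * y) = k * WittVector.verschiebung y := by
    intro k y
    rw [← zsmul_eq_mul, map_zsmul, zsmul_eq_mul]
  rw [map_add, map_add, h1, h1, ← WittVector.frobenius_verschiebung w,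
    WittVector.verschiebung_mul_frobenius]
  push_cast
  ring

/-- Let `p` be a prime and `B` a commutative ring such that `ℤ → B` is
injective. Let `S = {x ∈ W(B) : x.coeff 0 lies in the image of ℤ → B}`. Then:
(1) `S` is a subring of `W(B)`;
(2) every `x ∈ S` can be written uniquely as `x = n + V(z)` with `n ∈ ℤ` and
    `z ∈ W(B)`;
(3) the lateral Frobenius `𝔣 : S → S` defined by `𝔣(n + V(z)) = n + V(F(z))`
    is a ring homomorphism. -/
theorem lateral_frobenius_ring_hom
    (p : ℕ) [hp : Fact p.Prime] (B : Type*) [CommRing B]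
    (hB : Function.Injective (Int.cast : ℤ → B)) :
    ∃ T : Subring (WittVector p B),
      (T : Set (WittVector p B)) =
        {x : WittVector p B | ∃ n : ℤ, x.coeff 0 = (n : B)} ∧
      (∀ x ∈ T, ∃! nz : ℤ × WittVector p B,
        x = (nz.1 : WittVector p B) + WittVector.verschiebung nz.2) ∧
      ∃ 𝔣 : T →+* T,
        ∀ (n : ℤ) (z : WittVector p B)
          (h : (n : WittVector p B) + WittVector.verschiebung z ∈ T),
          (𝔣 ⟨(n : WittVector p B) + WittVector.verschiebung z, h⟩ :
              WittVector p B) =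
            (n : WittVector p B) +
              WittVector.verschiebung (WittVector.frobenius z) := by
  have c0 : ∀ (n : ℤ) (z : WittVector p B),
      WittVector.constantCoeff ((n : WittVector p B) + WittVector.verschiebung z) = (n : B) := by
    intro n z
    rw [map_add, map_intCast]
    have : WittVector.constantCoeff (WittVector.verschiebung z) = (0 : B) := rfl
    rw [this, add_zero]
  have uniq : ∀ (n m : ℤ) (z w : WittVector p B),
      (n : WittVector p B) + WittVector.verschiebung z = m + WittVector.verschiebung w →
      n = m ∧ z = w := by
    intro n m z w h
    have hnm : n = m := by
      apply hB
      have := congrArg WittVector.constantCoeff h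
      rwa [c0, c0] at this
    subst hnm
    exact ⟨rfl, WittVector.verschiebung_injective p B (add_left_cancel h)⟩
  let T : Subring (WittVector p B) := (Int.castRingHom B).range.comap WittVector.constantCoeff
  have hT : ∀ x : WittVector p B, x ∈ T ↔ ∃ n : ℤ, x.coeff 0 = (n : B) := by
    intro x
    constructor
    · rintro ⟨n, hn⟩
      exact ⟨n, hn.symm⟩
    · rintro ⟨n, hn⟩
      exact ⟨n, hn.symm⟩
  have mem : ∀ (n : ℤ) (z : WittVector p B),
      (n : WittVector p B) + WittVector.verschiebung z ∈ T := fun n z => ⟨n, (c0 n z).symm⟩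
  have ex : ∀ x : T, ∃ n : ℤ, ∃ z : WittVector p B,
      (x : WittVector p B) = n + WittVector.verschiebung z := by
    rintro ⟨x, n, hn⟩
    have h0 : WittVector.constantCoeff (x - (n : WittVector p B)) = (0 : B) := by
      rw [map_sub, map_intCast, ← hn]
      simp
    refine ⟨n, WittVector.mk p fun i => (x - (n : WittVector p B)).coeff (i + 1), ?_⟩
    rw [← sub_eq_iff_eq_add']
    ext i
    cases i with
    | zero => exact h0
    | succ i => rfl
  choose N Z hNZ using ex
  have key : ∀ (x : T) (n : ℤ) (z : WittVector p B),
      (x : WittVector p B) = n + WittVector.verschiebung z → N x = n ∧ Z x = z := by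
    intro x n z h
    exact uniq _ _ _ _ ((hNZ x).symm.trans h)
  let g : T → T := fun x =>
    ⟨(N x : WittVector p B) + WittVector.verschiebung (WittVector.frobenius (Z x)), mem _ _⟩
  have hg : ∀ (x : T) (n : ℤ) (z : WittVector p B),
      (x : WittVector p B) = n + WittVector.verschiebung z →
      (g x : WittVector p B) = n + WittVector.verschiebung (WittVector.frobenius z) := by
    intro x n z h
    obtain ⟨h1, h2⟩ := key x n z h
    simp only [g, h1, h2]
  refine ⟨T, Set.ext hT, ?_, ?_⟩
  · intro x hx
    refine ⟨(N ⟨x, hx⟩, Z ⟨x, hx⟩), hNZ ⟨x, hx⟩, ?_⟩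
    rintro ⟨n, z⟩ h
    obtain ⟨h1, h2⟩ := key ⟨x, hx⟩ n z h
    rw [h1, h2]
  · refine ⟨RingHom.mk' ⟨⟨g, ?_⟩, ?_⟩ ?_, ?_⟩
    · apply Subtype.ext
      rw [hg 1 1 0 (by simp)]
      simp
    · intro x y
      apply Subtype.ext
      rw [hg (x * y) _ _ (by rw [Subring.coe_mul, hNZ x, hNZ y, lat_aux_mul]), Subring.coe_mul]
      simp only [g]
      rw [lat_aux_mul]
      simp only [map_add, map_mul, map_intCast, map_natCast]
    · intro x y
      apply Subtype.ext
      change (g (x + y) : WittVector p B) = g x + g y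
      rw [hg (x + y) (N x + N y) (Z x + Z y) (by
        rw [Subring.coe_add, hNZ x, hNZ y]; push_cast; rw [map_add]; ring)]
      simp only [g]
      push_cast
      rw [map_add, map_add]
      ring
    · intro n z h
      exact hg ⟨_, h⟩ n z rfl
end

section
/- Let p be a prime, B a commutative ring, n an integer and z ∈ W(B) a p-typical Witt vector. Then for every i ≥ 0, the i-th coefficient of n + V(F(z)) is congruent modulo pB to the p-th power of the i-th coefficient of n + V(z); equivalently, the image of n + V(F(z)) in W(B/pB) equals the image of n + V(z) under the coefficientwise p-th power map. (This expresses that the lateral Frobenius 𝔣 : n + V(z) ↦ n + V(F(z)) is a lift of Frobenius.) -/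
/-- Let `p` be a prime, `B` a commutative ring, `n` an integer and `z ∈ W(B)` a
`p`-typical Witt vector. Then for every `i ≥ 0`, the `i`-th coefficient of
`n + V(F(z))` is congruent modulo `pB` to the `p`-th power of the `i`-th
coefficient of `n + V(z)`; equivalently, the image of `n + V(F(z))` in
`W(B/pB)` equals the image of `n + V(z)` under the coefficientwise `p`-th power
map. (This expresses that the lateral Frobenius `𝔣 : n + V(z) ↦ n + V(F(z))`
is a lift of Frobenius.) -/
theorem lateral_frobenius_is_frobenius_lift
    (p : ℕ) [hp : Fact p.Prime] (B : Type*) [CommRing B]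
    (n : ℤ) (z : WittVector p B) :
    (∀ i : ℕ,
      ((n : WittVector p B) +
          WittVector.verschiebung (WittVector.frobenius z)).coeff i -
        (((n : WittVector p B) + WittVector.verschiebung z).coeff i) ^ p ∈
        Ideal.span ({(p : B)} : Set B)) ∧
    (∀ i : ℕ,
      (WittVector.map (Ideal.Quotient.mk (Ideal.span ({(p : B)} : Set B)))
          ((n : WittVector p B) +
            WittVector.verschiebung (WittVector.frobenius z))).coeff i =
        ((WittVector.map (Ideal.Quotient.mk (Ideal.span ({(p : B)} : Set B)))
            ((n : WittVector p B) + WittVector.verschiebung z)).coeff i) ^ p) := by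
  have key : ∀ i : ℕ,
      (WittVector.map (Ideal.Quotient.mk (Ideal.span ({(p : B)} : Set B)))
          ((n : WittVector p B) +
            WittVector.verschiebung (WittVector.frobenius z))).coeff i =
        ((WittVector.map (Ideal.Quotient.mk (Ideal.span ({(p : B)} : Set B)))
            ((n : WittVector p B) + WittVector.verschiebung z)).coeff i) ^ p := by
    intro i
    by_cases hu : IsUnit (p : B)
    · have : Subsingleton (B ⧸ Ideal.span ({(p : B)} : Set B)) :=
        Ideal.Quotient.subsingleton_iff.2 (Ideal.span_singleton_eq_top.2 hu)
      exact Subsingleton.elim _ _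
    · haveI : CharP (B ⧸ Ideal.span ({(p : B)} : Set B)) p := CharP.quotient B p hu
      rw [← WittVector.coeff_frobenius_charP]
      congr 1
      have hF : WittVector.map (Ideal.Quotient.mk (Ideal.span ({(p : B)} : Set B)))
          (WittVector.frobenius z) = WittVector.frobenius (WittVector.map
            (Ideal.Quotient.mk (Ideal.span ({(p : B)} : Set B))) z) :=
        (WittVector.frobenius_isPoly p).map _ z
      rw [map_add, map_add, map_add, map_intCast, map_intCast,
        WittVector.map_verschiebung, WittVector.map_verschiebung, hF,
        WittVector.verschiebung_frobenius_comm]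
  refine ⟨fun i => ?_, key⟩
  have h := key i
  rw [WittVector.map_coeff, WittVector.map_coeff, ← map_pow] at h
  exact Ideal.Quotient.eq.1 h
end

section
/- Let p be a prime, R a complete discrete valuation ring of characteristic zero with uniformizer π, perfect residue field of characteristic p, and absolute ramification index e = v(p) ≤ p − 2; let K be the fraction field of R, and let q be a power of p. Let σ : K → K be a ring endomorphism with σ(R) ⊆ R and σ(x) ≡ x^q (mod πR) for all x ∈ R. Let m ≥ 1, let μ_1, …, μ_m ∈ K, and let F : K^m → K^m be the σ-semilinear map determined on the standard basis e_1, …, e_m by F(e_j) = e_{j+1} for 1 ≤ j ≤ m−1 and F(e_m) = μ_m e_1 + μ_{m−1} e_2 + ⋯ + μ_1 e_m. If there exists a finitely generated R-submodule M ⊆ K^m that spans K^m over K and satisfies F(M) ⊆ M, then μ_1, …, μ_m ∈ R. -/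
theorem aux_sigma_pi
    (p : ℕ) (R : Type*) [CommRing R] [IsDomain R] [IsDiscreteValuationRing R]
    (K : Type*) [Field K] [Algebra R K] [IsFractionRing R K]
    (π : R) (hπ : Irreducible π)
    (hres_char : CharP (IsLocalRing.ResidueField R) p)
    (e : ℕ) (he : Ideal.span ({(p : R)} : Set R) = Ideal.span ({π} : Set R) ^ e)
    (q : ℕ) (hq : 0 < q)
    (σ : K →+* K)
    (hσR : ∀ r : R, ∃ s : R,
      σ (algebraMap R K r) = algebraMap R K s ∧
      s - r ^ q ∈ Ideal.span ({π} : Set R)) :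
    ∃ u : R, IsUnit u ∧ σ (algebraMap R K π) = algebraMap R K (u * π) := by
  have hinj := IsFractionRing.injective R K
  have he0 : e ≠ 0 := by
    rintro rfl
    rw [pow_zero, Ideal.one_eq_top, Ideal.span_singleton_eq_top] at he
    have h0 : IsLocalRing.residue R (p : R) = 0 := by
      rw [map_natCast]; exact CharP.cast_eq_zero _ p
    rw [IsLocalRing.residue_eq_zero_iff] at h0
    exact h0 he
  rw [Ideal.span_singleton_pow, Ideal.span_singleton_eq_span_singleton] at he
  obtain ⟨w, hw⟩ := he.symm
  obtain ⟨s, hs, hs2⟩ := hσR π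
  obtain ⟨w', hw', hw2⟩ := hσR w
  rw [Ideal.mem_span_singleton] at hs2 hw2
  have hsd : π ∣ s := (dvd_sub_left (dvd_pow_self π hq.ne')).1 hs2
  obtain ⟨t, rfl⟩ := hsd
  have hw'u : IsUnit w' := by
    by_contra hc
    have hm : π ∣ w' := by
      have : w' ∈ IsLocalRing.maximalIdeal R := hc
      rwa [hπ.maximalIdeal_eq, Ideal.mem_span_singleton] at this
    have h2 : π ∣ (w : R) ^ q := (dvd_sub_right hm).1 hw2
    exact hπ.not_isUnit (isUnit_of_dvd_unit h2 (w.isUnit.pow q))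
  have key : π ^ e * (w : R) = (π * t) ^ e * w' := by
    apply hinj
    have h1 : σ (algebraMap R K (π ^ e * w)) = algebraMap R K (π ^ e * w) := by
      rw [hw]; simp
    rw [← h1, map_mul, map_mul, map_pow, map_pow, hs, hw', ← map_pow, ← map_mul]
  have key2 : (w : R) = t ^ e * w' := by
    apply mul_left_cancel₀ (pow_ne_zero e hπ.ne_zero)
    rw [key]; ring
  have ht : IsUnit t := by
    have : IsUnit (t ^ e * w') := key2 ▸ w.isUnit
    exact (isUnit_pow_iff he0).1 (isUnit_of_mul_isUnit_left this)
  exact ⟨t, ht, by rw [hs, mul_comm]⟩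

theorem aux_core
    (R : Type*) [CommRing R] [IsDomain R] [IsDiscreteValuationRing R]
    (K : Type*) [Field K] [Algebra R K] [IsFractionRing R K]
    (V : Type*) [AddCommGroup V] [Module K V] [Module R V] [IsScalarTower R K V]
    (π : R) (hπ : Irreducible π)
    (σ : K →+* K) (hσ : ∀ r : R, ∃ s : R, σ (algebraMap R K r) = algebraMap R K s)
    (u : R) (hu : IsUnit u) (hσπ : σ (algebraMap R K π) = algebraMap R K (u * π))
    (F : V → V)
    (hFadd : ∀ x y : V, F (x + y) = F x + F y)
    (hFsmul : ∀ (c : K) (x : V), F (c • x) = σ c • F x)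
    (M : Submodule R V) (hMfg : M.FG) (hMstable : ∀ x ∈ M, F x ∈ M)
    (v : ℕ → V) (hv : ∀ i, F (v i) = v (i + 1)) (D : ℕ) (hD : π ^ D • v 0 ∈ M)
    (m : ℕ) (c : ℕ → R) (hc : ∑ i ∈ Finset.range (m + 1), c i • v i = 0)
    (j : ℕ) (hj : j < m) (hcj : IsUnit (c j)) (hcj' : ∀ i, j < i → i ≤ m → π ∣ c i) :
    ∀ i, v i ∈ Submodule.span K (v '' Set.Iio j) := by
  have hFR : ∀ (r : R) (x : V), ∃ s : R, F (r • x) = s • F x := by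
    intro r x
    obtain ⟨s, hs⟩ := hσ r
    refine ⟨s, ?_⟩
    rw [← algebraMap_smul K r x, hFsmul, hs, algebraMap_smul]
  have hFπ : ∀ x : V, F (π • x) = π • u • F x := by
    intro x
    rw [← algebraMap_smul K π x, hFsmul, hσπ, algebraMap_smul, mul_comm, mul_smul]
  have hF0 : F 0 = 0 := by simpa using hFadd 0 0
  set w : ℕ → V := fun i => π ^ D • v i with hwdef
  have hFpow : ∀ (n : ℕ) (x : V), F (π ^ n • x) = u ^ n • π ^ n • F x := by
    intro n
    induction n with
    | zero => simp
    | succ n ih =>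
      intro x
      rw [pow_succ', mul_smul, hFπ, ih]
      simp only [smul_smul]; congr 1; ring
  have hFw : ∀ i, F (w i) = u ^ D • w (i + 1) := by
    intro i
    rw [hwdef]; simp only
    rw [hFpow, hv]
  have hunit : ∀ (N : Submodule R V) (a : R) (x : V), IsUnit a → a • x ∈ N → x ∈ N := by
    rintro N a x ⟨a, rfl⟩ h
    have := N.smul_mem (↑a⁻¹ : R) h
    rwa [smul_smul, Units.inv_mul, one_smul] at this
  have hwM : ∀ i, w i ∈ M := by
    intro i
    induction i with
    | zero => exact hD
    | succ i ih =>
      have := hMstable _ ih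
      rw [hFw] at this
      exact hunit M _ _ (hu.pow D) this
  set L : Submodule R V := Submodule.span R (Set.range w) with hL
  have hLM : L ≤ M := Submodule.span_le.2 (by rintro _ ⟨i, rfl⟩; exact hwM i)
  have hLfg : L.FG := by
    have : IsNoetherian R M := isNoetherian_of_fg_of_noetherian M hMfg
    exact Submodule.FG.of_le hMfg hLM
  have hwL : ∀ i, w i ∈ L := fun i => Submodule.subset_span ⟨i, rfl⟩
  have hFL : ∀ x ∈ L, F x ∈ L := by
    intro x hx
    induction hx using Submodule.span_induction with
    | mem x hx => obtain ⟨i, rfl⟩ := hx; rw [hFw]; exact L.smul_mem _ (hwL _)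
    | zero => rw [hF0]; exact L.zero_mem
    | add x y _ _ hx hy => rw [hFadd]; exact L.add_mem hx hy
    | smul a x _ hx => obtain ⟨s, hs⟩ := hFR a x; rw [hs]; exact L.smul_mem _ hx
  set N' : Submodule R V := Submodule.span R (w '' Set.Iio j) with hN'
  set I : Ideal R := Ideal.span {π} with hI
  have hπL : ∀ x ∈ L, π • x ∈ I • L := fun x hx =>
    Submodule.smul_mem_smul (Ideal.mem_span_singleton_self π) hx
  have hwj : w j ∈ N' ⊔ I • L := by
    have h1 : ∑ i ∈ Finset.range (m + 1), c i • w i = 0 := by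
      have : ∑ i ∈ Finset.range (m + 1), c i • w i
          = π ^ D • ∑ i ∈ Finset.range (m + 1), c i • v i := by
        rw [Finset.smul_sum]
        exact Finset.sum_congr rfl fun i _ => smul_comm _ _ _
      rw [this, hc, smul_zero]
    rw [← Finset.add_sum_erase _ _ (Finset.mem_range.2 (show j < m + 1 by omega))] at h1
    apply hunit _ _ _ hcj
    rw [eq_neg_of_add_eq_zero_left h1]
    apply Submodule.neg_mem
    apply Submodule.sum_mem
    intro i hi
    rw [Finset.mem_erase, Finset.mem_range] at hi
    rcases lt_or_gt_of_ne hi.1 with h | h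
    · exact Submodule.smul_mem _ _ (Submodule.mem_sup_left (Submodule.subset_span ⟨i, h, rfl⟩))
    · obtain ⟨b, hb⟩ := hcj' i h (by omega)
      rw [hb, mul_smul]
      exact Submodule.mem_sup_right (hπL _ (L.smul_mem _ (hwL i)))
  have hN'L : N' ≤ L := Submodule.span_mono (Set.image_subset_range _ _)
  have hFN' : ∀ x ∈ N', F x ∈ N' ⊔ I • L := by
    intro x hx
    induction hx using Submodule.span_induction with
    | mem x hx =>
      obtain ⟨i, hi, rfl⟩ := hx
      rw [hFw]
      apply Submodule.smul_mem
      rcases Nat.lt_or_ge (i + 1) j with h | h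
      · exact Submodule.mem_sup_left (Submodule.subset_span ⟨i + 1, h, rfl⟩)
      · have hij : i + 1 = j := le_antisymm hi h
        rw [hij]; exact hwj
    | zero => rw [hF0]; exact Submodule.zero_mem _
    | add x y _ _ hx hy => rw [hFadd]; exact Submodule.add_mem _ hx hy
    | smul a x _ hx => obtain ⟨s, hs⟩ := hFR a x; rw [hs]; exact Submodule.smul_mem _ _ hx
  have hFIL : ∀ x ∈ I • L, F x ∈ I • L := by
    intro x hx
    rw [hI, Submodule.ideal_span_singleton_smul] at hx
    obtain ⟨y, hy, rfl⟩ := hx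
    change F (π • y) ∈ _
    rw [hFπ]
    exact hπL _ (L.smul_mem _ (hFL _ hy))
  have hw0 : w 0 ∈ N' ⊔ I • L := by
    rcases Nat.eq_zero_or_pos j with h | h
    · rw [← h]; exact hwj
    · exact Submodule.mem_sup_left (Submodule.subset_span ⟨0, h, rfl⟩)
  have hwall : ∀ i, w i ∈ N' ⊔ I • L := by
    intro i
    induction i with
    | zero => exact hw0
    | succ i ih =>
      obtain ⟨a, ha, b, hb, hab⟩ := Submodule.mem_sup.1 ih
      apply hunit _ _ _ (hu.pow D)
      rw [← hFw, ← hab, hFadd]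
      exact Submodule.add_mem _ (hFN' a ha) (Submodule.mem_sup_right (hFIL b hb))
  have hLN : L ≤ N' := by
    apply Submodule.le_of_le_smul_of_le_jacobson_bot (I := I) hLfg
    · rw [IsLocalRing.jacobson_eq_maximalIdeal _ bot_ne_top, hπ.maximalIdeal_eq]
    · exact Submodule.span_le.2 (by rintro _ ⟨i, rfl⟩; exact hwall i)
  have hpi0 : algebraMap R K (π ^ D) ≠ 0 := by
    rw [Ne, IsFractionRing.to_map_eq_zero_iff]
    exact pow_ne_zero _ hπ.ne_zero
  have hsub : N' ≤ (Submodule.span K (v '' Set.Iio j)).restrictScalars R := by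
    rw [hN', Submodule.span_le]
    rintro _ ⟨i, hi, rfl⟩
    exact Submodule.smul_mem (Submodule.restrictScalars R _) _
      (Submodule.subset_span (R := K) ⟨i, hi, rfl⟩)
  intro i
  have h1 : w i ∈ Submodule.span K (v '' Set.Iio j) := hsub (hLN (hwL i))
  have h2 := Submodule.smul_mem _ (algebraMap R K (π ^ D))⁻¹ h1
  rw [hwdef] at h2
  simp only at h2
  rwa [← algebraMap_smul K (π ^ D) (v i), smul_smul, inv_mul_cancel₀ hpi0, one_smul] at h2

theorem aux_clear
    (R : Type*) [CommRing R] [IsDomain R] [IsDiscreteValuationRing R]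
    (K : Type*) [Field K] [Algebra R K] [IsFractionRing R K]
    (π : R) (hπ : Irreducible π) (r : R) (hr : r ≠ 0) :
    ∃ (D : ℕ) (a : Rˣ), r = a * π ^ D :=
  IsDiscreteValuationRing.eq_unit_mul_pow_irreducible hr hπ


/-- **Integrality from a stable lattice (mixed-characteristic Dieudonné–Manin
lemma).**
Let `p` be a prime, `R` a complete discrete valuation ring of characteristic
zero with uniformizer `π`, perfect residue field of characteristic `p`, and
absolute ramification index `e = v(p) ≤ p − 2`; let `K` be the fraction field
of `R`, and let `q` be a positive power of `p`. Let `σ : K → K` be a ring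
endomorphism mapping `R` into `R` with `σ(x) ≡ x^q (mod πR)` for all `x ∈ R`.
Let `m ≥ 1`, `μ_1, …, μ_m ∈ K` (here `μ i` is `μ_{i+1}`), and let
`F : K^m → K^m` be the `σ`-semilinear map with `F(e_j) = e_{j+1}` for
`1 ≤ j ≤ m−1` and `F(e_m) = μ_m e_1 + μ_{m−1} e_2 + ⋯ + μ_1 e_m`. If there
exists a finitely generated `R`-submodule `M ⊆ K^m` that spans `K^m` over `K`
and satisfies `F(M) ⊆ M`, then `μ_1, …, μ_m ∈ R`. -/
theorem integrality_of_semilinear_companion_with_stable_lattice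
    (p : ℕ) (hp : p.Prime)
    (R : Type*) [CommRing R] [IsDomain R] [IsDiscreteValuationRing R]
    [CharZero R] [IsAdicComplete (IsLocalRing.maximalIdeal R) R]
    (K : Type*) [Field K] [Algebra R K] [IsFractionRing R K]
    (π : R) (hπ : Irreducible π)
    (hres_char : CharP (IsLocalRing.ResidueField R) p)
    (hres_perfect : ∀ x : IsLocalRing.ResidueField R, ∃ y, y ^ p = x)
    (e : ℕ) (he : Ideal.span ({(p : R)} : Set R) = Ideal.span ({π} : Set R) ^ e)
    (hep : e ≤ p - 2)
    (q : ℕ) (hq : ∃ f : ℕ, 0 < f ∧ q = p ^ f)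
    (σ : K →+* K)
    (hσR : ∀ r : R, ∃ s : R,
      σ (algebraMap R K r) = algebraMap R K s ∧
      s - r ^ q ∈ Ideal.span ({π} : Set R))
    (m : ℕ) (hm : 1 ≤ m) (μ : Fin m → K)
    (F : (Fin m → K) → (Fin m → K))
    (hFadd : ∀ x y : Fin m → K, F (x + y) = F x + F y)
    (hFsmul : ∀ (c : K) (x : Fin m → K), F (c • x) = σ c • F x)
    (hFbasis : ∀ j : Fin m,
      F (Pi.single j 1) =
        if h : (j : ℕ) + 1 < m then Pi.single (⟨(j : ℕ) + 1, h⟩ : Fin m) 1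
        else fun i : Fin m => μ i.rev)
    (M : Submodule R (Fin m → K)) (hMfg : M.FG)
    (hMspan : Submodule.span K (M : Set (Fin m → K)) = ⊤)
    (hMstable : ∀ x ∈ M, F x ∈ M) :
    ∀ i : Fin m, ∃ r : R, μ i = algebraMap R K r := by
  classical
  have hinj := IsFractionRing.injective R K
  have hq0 : 0 < q := by
    obtain ⟨f, _, rfl⟩ := hq
    exact pow_pos hp.pos f
  obtain ⟨u, hu, hσπ⟩ := aux_sigma_pi p R K π hπ hres_char e he q hq0 σ hσR
  have hπK : algebraMap R K π ≠ 0 := by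
    rw [Ne, IsFractionRing.to_map_eq_zero_iff]; exact hπ.ne_zero
  -- bounded denominators of vectors
  have hden : ∀ x : Fin m → K, ∃ r : R, r ≠ 0 ∧ r • x ∈ M := by
    intro x
    have hx : x ∈ Submodule.span K (M : Set (Fin m → K)) := hMspan ▸ Submodule.mem_top
    induction hx using Submodule.span_induction with
    | mem x hx => exact ⟨1, one_ne_zero, by rwa [one_smul]⟩
    | zero => exact ⟨1, one_ne_zero, by simp⟩
    | add x y _ _ hx hy =>
      obtain ⟨r, hr, hrx⟩ := hx
      obtain ⟨s, hs, hsy⟩ := hy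
      refine ⟨r * s, mul_ne_zero hr hs, ?_⟩
      rw [smul_add]
      refine M.add_mem ?_ ?_
      · rw [mul_comm, mul_smul]; exact M.smul_mem _ hrx
      · rw [mul_smul]; exact M.smul_mem _ hsy
    | smul a x _ hx =>
      obtain ⟨r, hr, hrx⟩ := hx
      obtain ⟨b, s, hs, rfl⟩ := IsFractionRing.div_surjective (A := R) a
      have hs0 : s ≠ 0 := nonZeroDivisors.ne_zero hs
      have hs1 : algebraMap R K s ≠ 0 := by
        rw [Ne, IsFractionRing.to_map_eq_zero_iff]; exact hs0
      refine ⟨r * s, mul_ne_zero hr hs0, ?_⟩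
      have : (r * s) • ((algebraMap R K b / algebraMap R K s) • x) = b • (r • x) := by
        rw [← algebraMap_smul K (r * s), ← algebraMap_smul K b, ← algebraMap_smul K r,
          smul_smul, smul_smul]
        congr 1
        rw [map_mul]; field_simp
      rw [this]; exact M.smul_mem _ hrx
  set e0 : Fin m → K := Pi.single ⟨0, hm⟩ 1 with he0
  obtain ⟨r0, hr0, hr0M⟩ := hden e0
  obtain ⟨D, a, hDa⟩ := aux_clear R K π hπ r0 hr0
  have hDM : π ^ D • e0 ∈ M := by
    have := M.smul_mem (↑a⁻¹ : R) hr0M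
    rwa [hDa, smul_smul, ← mul_assoc, Units.inv_mul, one_mul] at this
  set v : ℕ → (Fin m → K) := fun i => F^[i] e0 with hvdef
  have hv : ∀ i, F (v i) = v (i + 1) := fun i => (Function.iterate_succ_apply' F i e0).symm
  have hvi : ∀ (i : ℕ) (h : i < m), v i = Pi.single ⟨i, h⟩ 1 := by
    intro i
    induction i with
    | zero => intro h; rfl
    | succ i ih =>
      intro h
      rw [← hv, ih (by omega), hFbasis, dif_pos h]
  have hvm : v m = fun i : Fin m => μ i.rev := by
    obtain ⟨k, rfl⟩ : ∃ k, m = k + 1 := ⟨m - 1, by omega⟩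
    rw [← hv, hvi k (by omega), hFbasis, dif_neg (by simp)]
  -- minimal power of π clearing denominators
  have hex : ∃ d : ℕ, ∀ i : Fin m, ∃ r : R, algebraMap R K π ^ d * μ i = algebraMap R K r := by
    have h1 : ∀ i : Fin m, ∃ d : ℕ, ∃ r : R, algebraMap R K π ^ d * μ i = algebraMap R K r := by
      intro i
      obtain ⟨b, s, hs, hbs⟩ := IsFractionRing.div_surjective (A := R) (μ i)
      obtain ⟨d, a, hda⟩ := aux_clear R K π hπ s (nonZeroDivisors.ne_zero hs)
      refine ⟨d, (↑a⁻¹ : R) * b, ?_⟩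
      have ha : algebraMap R K (a : R) * algebraMap R K (↑a⁻¹ : R) = 1 := by
        rw [← map_mul, Units.mul_inv, map_one]
      have ha0 : algebraMap R K (a : R) ≠ 0 := left_ne_zero_of_mul_eq_one ha
      rw [← hbs, hda, map_mul, map_mul, map_pow, eq_inv_of_mul_eq_one_right ha]
      field_simp
    choose d hd using h1
    refine ⟨∑ i, d i, fun i => ?_⟩
    obtain ⟨r, hr⟩ := hd i
    refine ⟨π ^ (∑ k ∈ Finset.univ.erase i, d k) * r, ?_⟩
    rw [← Finset.add_sum_erase _ _ (Finset.mem_univ i), map_mul, ← hr, map_pow, pow_add]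
    ring
  set d := Nat.find hex with hd
  have hds := Nat.find_spec hex
  rw [← hd] at hds
  rcases Nat.eq_zero_or_pos d with h0 | hpos
  · intro i
    obtain ⟨r, hr⟩ := hds i
    exact ⟨r, by simpa [h0] using hr⟩
  exfalso
  choose b hb using hds
  have hnot : ∃ i : Fin m, ¬ π ∣ b i := by
    by_contra! hall
    apply Nat.find_min hex (m := d - 1) (by omega)
    intro i
    obtain ⟨t, ht⟩ := hall i
    refine ⟨t, ?_⟩
    apply mul_left_cancel₀ hπK
    rw [← mul_assoc, ← pow_succ', Nat.sub_add_cancel hpos, hb, ht, map_mul]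
  set c : ℕ → R := fun i => if h : i < m then b (Fin.rev ⟨i, h⟩) else - π ^ d with hcdef
  have hc : ∑ i ∈ Finset.range (m + 1), c i • v i = 0 := by
    rw [Finset.sum_range_succ, Finset.sum_range]
    have hcm : c m = - π ^ d := by simp [hcdef]
    rw [hcm, hvm]
    ext k
    have h2 : ∀ i : Fin m, c i • v i = Pi.single i (algebraMap R K (b i.rev)) := by
      intro i
      have : c i = b i.rev := by simp [hcdef]
      rw [this, hvi i i.2, ← Pi.single_smul, Algebra.smul_def, mul_one]
    simp only [h2]
    rw [Finset.univ_sum_single (fun i : Fin m => algebraMap R K (b i.rev))]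
    rw [Pi.add_apply, Pi.smul_apply, Pi.zero_apply, Algebra.smul_def, map_neg, map_pow, ← hb]
    ring
  set P : ℕ → Prop := fun i => i < m ∧ ¬ π ∣ c i with hP
  have hPex : ∃ i, i ≤ m ∧ P i := by
    obtain ⟨i, hi⟩ := hnot
    refine ⟨i.rev, i.rev.2.le, i.rev.2, ?_⟩
    have h3 : c i.rev = b i := by
      have : c i.rev = b i.rev.rev := by
        rw [hcdef]; exact dif_pos i.rev.2
      rw [this, Fin.rev_rev]
    rw [h3]; exact hi
  obtain ⟨i1, hi1, hPi1⟩ := hPex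
  set j := Nat.findGreatest P m with hj
  have hPj : P j := Nat.findGreatest_spec hi1 hPi1
  have hcj : IsUnit (c j) := by
    by_contra hcon
    have : c j ∈ IsLocalRing.maximalIdeal R := hcon
    rw [hπ.maximalIdeal_eq, Ideal.mem_span_singleton] at this
    exact hPj.2 this
  have hcj' : ∀ i, j < i → i ≤ m → π ∣ c i := by
    intro i hji him
    rcases him.lt_or_eq with h | h
    · by_contra hcon
      exact Nat.findGreatest_is_greatest hji him ⟨h, hcon⟩
    · subst h
      have hcm : c i = - π ^ d := by simp [hcdef]
      rw [hcm]
      exact (dvd_pow_self π hpos.ne').neg_right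
  have hcore := aux_core R K (Fin m → K) π hπ σ
    (fun r => (hσR r).imp fun _ h => h.1) u hu hσπ F hFadd hFsmul M hMfg hMstable v hv D hDM
    m c hc j hPj.1 hcj hcj' j
  -- v j = e_j is not in the span of e_i, i < j
  have hker : Submodule.span K (v '' Set.Iio j) ≤
      LinearMap.ker (LinearMap.proj (R := K) (φ := fun _ : Fin m => K) ⟨j, hPj.1⟩) := by
    rw [Submodule.span_le]
    rintro _ ⟨i, hi, rfl⟩
    have hi' : i < j := hi
    rw [hvi i (hi'.trans hPj.1)]
    simp [Fin.ext_iff, Pi.single_apply, hi'.ne']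
  have := hker hcore
  rw [hvi j hPj.1] at this
  simp at this
end
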